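/- For every natural number k, the polynomial Q_k, viewed with real coefficients, factors as Q_k(X) = ∏_{j=1}^{k} (X + 4·sin²(jπ/(2(k+1)))). In particular, the roots of Q_k are exactly the k negative real numbers −4·sin²(jπ/(2(k+1))) for 1 ≤ j ≤ k. -/

import Mathlib

open Polynomial Real

/-- The polynomial `Q_k(T) = ∑_{j=0}^{k} binom(k+j+1, 2j+1) * T^j` with rational
coefficients. -/
noncomputable def Q (k : ℕ) : ℚ[X] :=
  ∑ j ∈ Finset.range (k + 1), C ((Nat.choose (k + j + 1) (2 * j + 1) : ℚ)) * X ^ j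

lemma Q_coeff (k j : ℕ) : (Q k).coeff j = (Nat.choose (k + j + 1) (2 * j + 1) : ℚ) := by
  simp only [Q, finsetSum_coeff, coeff_C_mul, coeff_X_pow, mul_ite, mul_one, mul_zero]
  rw [Finset.sum_ite_eq]
  split_ifs with h
  · rfl
  · rw [Finset.mem_range] at h
    rw [Nat.choose_eq_zero_of_lt (by omega)]
    simp

lemma Q_rec (k : ℕ) : Q (k + 2) = (X + 2) * Q (k + 1) - Q k := by
  ext j
  have h2 : (2 : ℚ[X]) = C 2 := rfl
  rw [add_mul, h2]
  rcases j with _ | j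
  · simp only [coeff_sub, coeff_add, coeff_C_mul, mul_coeff_zero, coeff_X_zero, Q_coeff]
    simp
    ring
  · simp only [coeff_sub, coeff_add, coeff_C_mul, coeff_X_mul, Q_coeff]
    have e1 : k + 2 + (j + 1) + 1 = (k + j + 2) + 1 + 1 := by ring
    have e2 : k + 1 + (j + 1) + 1 = (k + j + 2) + 1 := by ring
    have e3 : k + (j + 1) + 1 = k + j + 2 := by ring
    have e4 : k + 1 + j + 1 = k + j + 2 := by ring
    have e5 : 2 * (j + 1) + 1 = (2 * j + 1) + 1 + 1 := by ring
    rw [e1, e2, e3, e4, e5]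
    simp only [Nat.choose_succ_succ' _ _]
    push_cast
    ring

lemma Q_eval (θ : ℝ) (k : ℕ) :
    aeval (2 * cos θ - 2) (Q k) * sin θ = sin ((k + 1) * θ) := by
  induction k using Nat.twoStepInduction with
  | zero => simp [Q]
  | one =>
    simp [Q, Finset.sum_range_succ, map_ofNat]
    rw [show ((1 : ℝ) + 1) * θ = 2 * θ by ring, sin_two_mul]
    ring
  | more k h1 h2 =>
    rw [Q_rec]
    simp only [map_sub, map_mul, map_add, aeval_X, map_ofNat]
    push_cast at h2 ⊢
    have : sin ((k + 2 + 1) * θ) = 2 * cos θ * sin ((k + 1 + 1) * θ) - sin ((k + 1) * θ) := by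
      rw [show ((k : ℝ) + 2 + 1) * θ = (k + 1 + 1) * θ + θ by ring,
        show ((k : ℝ) + 1) * θ = (k + 1 + 1) * θ - θ by ring, sin_add, sin_sub]
      ring
    rw [this, ← h1, ← h2]
    ring

lemma Q_natDegree_le (k : ℕ) : (Q k).natDegree ≤ k := by
  rw [natDegree_le_iff_coeff_eq_zero]
  intro N hN
  rw [Q_coeff, Nat.choose_eq_zero_of_lt (by omega)]
  simp

lemma Q_coeff_self (k : ℕ) : (Q k).coeff k = 1 := by
  rw [Q_coeff, show k + k + 1 = 2 * k + 1 by ring]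
  simp

lemma Q_monic (k : ℕ) : (Q k).Monic :=
  monic_of_natDegree_le_of_coeff_eq_one k (Q_natDegree_le k) (Q_coeff_self k)

lemma Q_natDegree (k : ℕ) : (Q k).natDegree = k :=
  le_antisymm (Q_natDegree_le k) (le_natDegree_of_ne_zero (by rw [Q_coeff_self]; simp))

lemma angle_eq (k j : ℕ) : -(4 * Real.sin (j * π / (2 * (k + 1))) ^ 2) =
    2 * cos (j * π / (k + 1)) - 2 := by
  have hk : (k : ℝ) + 1 ≠ 0 := by positivity
  rw [show (j : ℝ) * π / (k + 1) = 2 * (j * π / (2 * (k + 1))) by field_simp, cos_two_mul, cos_sq']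
  ring

lemma angle_mem {k j : ℕ} (hj : j ∈ Finset.Icc 1 k) :
    0 < (j : ℝ) * π / (k + 1) ∧ (j : ℝ) * π / (k + 1) < π := by
  rw [Finset.mem_Icc] at hj
  have h1 : (0 : ℝ) < j := by exact_mod_cast hj.1
  have h2 : (j : ℝ) ≤ k := by exact_mod_cast hj.2
  have := pi_pos
  constructor
  · positivity
  · rw [div_lt_iff₀ (by positivity)]
    nlinarith

lemma Q_root {k j : ℕ} (hj : j ∈ Finset.Icc 1 k) :
    aeval (-(4 * Real.sin (j * π / (2 * (k + 1))) ^ 2)) (Q k) = 0 := by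
  rw [angle_eq]
  have h := Q_eval (j * π / (k + 1)) k
  have hk : (k : ℝ) + 1 ≠ 0 := by positivity
  rw [show ((k : ℝ) + 1) * (j * π / (k + 1)) = j * π by field_simp, sin_nat_mul_pi] at h
  have hs := sin_pos_of_pos_of_lt_pi (angle_mem hj).1 (angle_mem hj).2
  exact (mul_eq_zero.1 h).resolve_right hs.ne'

lemma Q_factor (k : ℕ) : (Q k).map (algebraMap ℚ ℝ) =
      ∏ j ∈ Finset.Icc 1 k, (X + C (4 * Real.sin (j * π / (2 * (k + 1))) ^ 2)) := by
  have hX : ∀ j : ℕ, (X + C (4 * Real.sin (j * π / (2 * (k + 1))) ^ 2) : ℝ[X]) =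
      X - C (-(4 * Real.sin (j * π / (2 * (k + 1))) ^ 2)) := by
    intro j; simp
  simp only [hX]
  apply eq_of_monic_of_dvd_of_natDegree_le
  · exact monic_prod_of_monic _ _ fun j _ => monic_X_sub_C _
  · exact (Q_monic k).map _
  · apply Finset.prod_dvd_of_coprime
    · intro i hi j hj hij
      refine isCoprime_X_sub_C_of_isUnit_sub ?_
      rw [isUnit_iff_ne_zero, sub_ne_zero, angle_eq, angle_eq]
      intro h
      apply hij
      have hi' := angle_mem hi
      have hj' := angle_mem hj
      have := injOn_cos ⟨hi'.1.le, hi'.2.le⟩ ⟨hj'.1.le, hj'.2.le⟩ (by linarith)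
      have hk : (k : ℝ) + 1 ≠ 0 := by positivity
      have hp := pi_ne_zero
      field_simp at this
      exact_mod_cast this
    · intro j hj
      rw [dvd_iff_isRoot, IsRoot, eval_map_algebraMap]
      exact Q_root hj
  · rw [natDegree_map, Q_natDegree, natDegree_prod_of_monic _ _ fun j _ => monic_X_sub_C _]
    simp only [natDegree_X_sub_C]
    simp

theorem stmt_5 (k : ℕ) :
    (Q k).map (algebraMap ℚ ℝ) =
      ∏ j ∈ Finset.Icc 1 k, (X + C (4 * Real.sin (j * π / (2 * (k + 1))) ^ 2)) ∧
    (∀ x : ℝ, Polynomial.aeval x (Q k) = 0 ↔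
      ∃ j ∈ Finset.Icc 1 k, x = -(4 * Real.sin (j * π / (2 * (k + 1))) ^ 2)) := by
  refine ⟨Q_factor k, fun x => ?_⟩
  rw [← eval_map_algebraMap, Q_factor, eval_prod, Finset.prod_eq_zero_iff]
  simp only [eval_add, eval_X, eval_C, add_eq_zero_iff_eq_neg]
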